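/- arXiv:1505.03357 — 4 statements merged into one kernel-verified Lean document; each statement's English description precedes it below -/
import Mathlib

section
/- Let V be a type, G a simple graph on V, and w : Sym2 V → ZMod 2 an edge labeling. If there exists a closed walk in G whose weight is 1 (where the weight of a walk is the sum in ZMod 2 of w over the list of its edges), then there exists a closed walk which is a cycle (i.e., a simple closed walk, Walk.IsCycle) whose weight is 1. -/
theorem aux_path_edge {V : Type*} {G : SimpleGraph V} {u v : V} (p : G.Walk v u)
    (hp : p.IsPath) (he : s(u, v) ∈ p.edges) : p.edges = [s(u, v)] := by
  cases p with
  | nil => simp at he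
  | cons h q =>
    rw [SimpleGraph.Walk.cons_isPath_iff] at hp
    rw [SimpleGraph.Walk.edges_cons, List.mem_cons] at he
    rcases he with he | he
    · rw [Sym2.eq_swap] at he
      have := Sym2.congr_right.mp he
      subst this
      have := SimpleGraph.Walk.isPath_iff_eq_nil |>.mp hp.1
      subst this
      simp [Sym2.eq_swap]
    · exact absurd (q.snd_mem_support_of_mem_edges he) hp.2

theorem aux_bypass {V : Type*} [DecidableEq V] {G : SimpleGraph V} (w : Sym2 V → ZMod 2)
    (H : ∀ (v : V) (p : G.Walk v v), p.IsCycle → (p.edges.map w).sum ≠ 1)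
    {u v : V} (p : G.Walk u v) : (p.edges.map w).sum = (p.bypass.edges.map w).sum := by
  have Z : ∀ x : ZMod 2, x ≠ 1 → x = 0 := by decide
  have Z2 : ∀ x : ZMod 2, x + x = 0 := by decide
  induction p with
  | nil => rfl
  | @cons u v x h p ih =>
    simp only [SimpleGraph.Walk.bypass]
    split_ifs with hs
    · have key : w s(u, v) + ((p.bypass.takeUntil u hs).edges.map w).sum = 0 := by
        have hpath := p.bypass_isPath.takeUntil hs
        by_cases he : s(u, v) ∈ (p.bypass.takeUntil u hs).edges
        · rw [aux_path_edge _ hpath he]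
          simp [Z2]
        · have := H u (.cons h (p.bypass.takeUntil u hs))
            ((SimpleGraph.Walk.cons_isCycle_iff _ _).mpr ⟨hpath, he⟩)
          simpa using Z _ this
      have hsp := congrArg (fun q => (q.edges.map w).sum) (p.bypass.take_spec hs)
      simp only [SimpleGraph.Walk.edges_append, List.map_append, List.sum_append] at hsp
      rw [SimpleGraph.Walk.edges_cons, List.map_cons, List.sum_cons, ih, ← hsp, ← add_assoc, key,
        zero_add]
    · simp [ih]

/-- If some closed walk has weight 1, then some cycle has weight 1. -/
theorem exists_cycle_weight_one_of_closed_walk_weight_one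
    {V : Type*} (G : SimpleGraph V) (w : Sym2 V → ZMod 2)
    (h : ∃ (v : V) (p : G.Walk v v), (p.edges.map w).sum = 1) :
    ∃ (v : V) (p : G.Walk v v), p.IsCycle ∧ (p.edges.map w).sum = 1 := by
  classical
  by_contra hc
  obtain ⟨v, p, hp⟩ := h
  have := aux_bypass w (fun v p h1 h2 => hc ⟨v, p, h1, h2⟩) p
  rw [hp, SimpleGraph.Walk.isPath_iff_eq_nil.mp p.bypass_isPath] at this
  simp at this
end

section
/- Let V be a type, G a simple graph on V, and w : Sym2 V → ZMod 2 an edge labeling. If G is acyclic (G.IsAcyclic), then for every labeling w there exists a consistent assignment σ : V → ZMod 2, i.e., σ u + σ v = w {u,v} for every pair of adjacent vertices u, v. -/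
/-- An acyclic graph admits a consistent assignment for every edge
labeling. -/
theorem acyclic_consistent_assignment_exists
    {V : Type*} (G : SimpleGraph V) (hG : G.IsAcyclic) :
    ∀ w : Sym2 V → ZMod 2,
      ∃ σ : V → ZMod 2, ∀ u v : V, G.Adj u v → σ u + σ v = w s(u, v) := by
  classical
  intro w
  have hr : ∀ v : V, ∃ p : G.Walk (G.connectedComponentMk v).out v, p.IsPath := by
    intro v
    have h : G.Reachable (G.connectedComponentMk v).out v :=
      SimpleGraph.ConnectedComponent.exact (Quot.out_eq (G.connectedComponentMk v))
    obtain ⟨p⟩ := h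
    exact ⟨p.toPath.1, p.toPath.2⟩
  choose p hp using hr
  have key : ∀ (a u v : V) (q : G.Walk a u) (q' : G.Walk a v), q.IsPath → q'.IsPath →
      G.Adj u v → (q.edges.map w).sum + (q'.edges.map w).sum = w s(u, v) := by
    intro a u v q q' hq hq' huv
    by_cases hv : v ∈ q.support
    · have h := hG.path_concat hq' hq huv.symm hv
      rw [h, SimpleGraph.Walk.edges_concat, List.concat_eq_append, List.map_append,
        List.sum_append, Sym2.eq_swap]
      simp only [List.map_cons, List.map_nil, List.sum_cons, List.sum_nil, add_zero]
      rw [add_right_comm, CharTwo.add_self_eq_zero, zero_add]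
    · have hu : u ∈ q'.support :=
        hG.mem_support_of_ne_mem_support_of_adj_of_isPath hq' hq huv.symm hv
      have h := hG.path_concat hq hq' huv hu
      rw [h, SimpleGraph.Walk.edges_concat, List.concat_eq_append, List.map_append,
        List.sum_append]
      simp only [List.map_cons, List.map_nil, List.sum_cons, List.sum_nil, add_zero]
      rw [← add_assoc, CharTwo.add_self_eq_zero, zero_add]
  refine ⟨fun v => ((p v).edges.map w).sum, fun u v huv => ?_⟩
  have e : (G.connectedComponentMk v).out = (G.connectedComponentMk u).out := by
    rw [SimpleGraph.ConnectedComponent.sound huv.symm.reachable]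
  have h := key _ u v (p u) ((p v).copy e rfl) (hp u) (by simpa using hp v) huv
  simpa using h
end

section
/- Let V be a finite type, G a simple graph on V, and f : V → ℕ. Define step : (V → ℕ) → (V → ℕ) by step g v = the maximum of g over the set consisting of v together with its neighbors in G. Then for every k : ℕ and every vertex v, (step^[k] f) v equals the maximum of f u over all vertices u for which there exists a walk in G from u to v of length at most k. -/
open scoped Classical

/-- One round of label propagation: every vertex adopts the maximum label
over its closed neighborhood. -/
noncomputable def propagateStep {V : Type*} [Fintype V] (G : SimpleGraph V)
    (g : V → ℕ) (v : V) : ℕ :=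
  (insert v (G.neighborFinset v)).sup g

/-- After `k` rounds of label propagation, the label at `v` is the maximum of
`f u` over all vertices `u` admitting a walk to `v` of length at most `k`. -/
theorem propagateStep_iterate_eq_sup_of_walk_length_le
    {V : Type*} [Fintype V] (G : SimpleGraph V) (f : V → ℕ) (k : ℕ) (v : V) :
    ((propagateStep G)^[k] f) v =
      (Finset.univ.filter fun u : V => ∃ p : G.Walk u v, p.length ≤ k).sup f := by
  induction k generalizing v with
  | zero =>
    have h : (Finset.univ.filter fun u : V => ∃ p : G.Walk u v, p.length ≤ 0) = {v} := by
      ext u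
      simp only [Finset.mem_filter, Finset.mem_univ, true_and, Finset.mem_singleton]
      constructor
      · rintro ⟨p, hp⟩
        exact SimpleGraph.Walk.eq_of_length_eq_zero (Nat.le_zero.mp hp)
      · rintro rfl
        exact ⟨SimpleGraph.Walk.nil, by simp⟩
    rw [h]
    simp
  | succ k ih =>
    rw [Function.iterate_succ_apply']
    unfold propagateStep at ih ⊢
    apply le_antisymm
    · apply Finset.sup_le
      intro w hw
      rw [ih w]
      apply Finset.sup_mono
      intro u hu
      simp only [Finset.mem_filter, Finset.mem_univ, true_and] at hu ⊢
      obtain ⟨p, hp⟩ := hu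
      rw [Finset.mem_insert, SimpleGraph.mem_neighborFinset] at hw
      rcases hw with rfl | hw
      · exact ⟨p, by omega⟩
      · exact ⟨p.concat hw.symm, by rw [SimpleGraph.Walk.length_concat]; omega⟩
    · apply Finset.sup_le
      intro u hu
      simp only [Finset.mem_filter, Finset.mem_univ, true_and] at hu
      obtain ⟨p, hp⟩ := hu
      have key : ∃ w ∈ insert v (G.neighborFinset v), ∃ q : G.Walk u w, q.length ≤ k := by
        rw [← SimpleGraph.Walk.length_reverse] at hp
        generalize p.reverse = r at hp
        cases r with
        | nil => exact ⟨v, by simp, SimpleGraph.Walk.nil, by simp⟩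
        | @cons _ w _ h q =>
          refine ⟨w, by simp [h], q.reverse, ?_⟩
          rw [SimpleGraph.Walk.length_cons] at hp
          rw [SimpleGraph.Walk.length_reverse]
          omega
      obtain ⟨w, hw, hq⟩ := key
      refine le_trans ?_ (Finset.le_sup hw)
      rw [ih w]
      exact Finset.le_sup (f := f) (by simpa using hq)
end

section
/- Let V be a finite type, G a simple graph on V, and f : V → ℕ. Define step : (V → ℕ) → (V → ℕ) by step g v = the maximum of g over the set consisting of v together with its neighbors in G. Then for every k ≥ Fintype.card V and every vertex v, (step^[k] f) v equals the maximum of f u over all vertices u with G.Reachable u v. -/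
open scoped Classical

theorem prop_upper {V : Type*} [Fintype V] (G : SimpleGraph V) (f : V → ℕ) (k : ℕ) :
    ∀ v, ((propagateStep G)^[k] f) v ≤
      (Finset.univ.filter fun u : V => G.Reachable u v).sup f := by
  induction k with
  | zero =>
    intro v
    exact Finset.le_sup (f := f) (by simp)
  | succ k ih =>
    intro v
    rw [Function.iterate_succ_apply']
    refine Finset.sup_le fun w hw => (ih w).trans (Finset.sup_mono fun u hu => ?_)
    simp only [Finset.mem_filter, Finset.mem_univ, true_and] at hu ⊢
    rw [Finset.mem_insert, SimpleGraph.mem_neighborFinset] at hw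
    rcases hw with rfl | hw
    · exact hu
    · exact hu.trans hw.symm.reachable

theorem prop_self {V : Type*} [Fintype V] (G : SimpleGraph V) (f : V → ℕ) (k : ℕ) (v : V) :
    f v ≤ ((propagateStep G)^[k] f) v := by
  induction k with
  | zero => exact le_rfl
  | succ k ih =>
    rw [Function.iterate_succ_apply']
    exact ih.trans (Finset.le_sup (f := (propagateStep G)^[k] f) (Finset.mem_insert_self _ _))

theorem prop_lower {V : Type*} [Fintype V] (G : SimpleGraph V) (f : V → ℕ) {v u : V}
    (p : G.Walk v u) : ∀ k, p.length ≤ k → f u ≤ ((propagateStep G)^[k] f) v := by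
  induction p with
  | nil => exact fun k _ => prop_self G f k _
  | cons h p ih =>
    intro k hk
    rw [SimpleGraph.Walk.length_cons] at hk
    obtain ⟨k, rfl⟩ : ∃ j, k = j + 1 := ⟨k - 1, by omega⟩
    rw [Function.iterate_succ_apply']
    exact (ih k (by omega)).trans (Finset.le_sup (f := (propagateStep G)^[k] f)
      (Finset.mem_insert_of_mem ((SimpleGraph.mem_neighborFinset _ _ _).2 h)))

/-- After at least `Fintype.card V` rounds of label propagation, the label at
`v` is the maximum of `f` over the connected component of `v`. -/
theorem propagateStep_iterate_eq_sup_component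
    {V : Type*} [Fintype V] (G : SimpleGraph V) (f : V → ℕ) (k : ℕ)
    (hk : Fintype.card V ≤ k) (v : V) :
    ((propagateStep G)^[k] f) v =
      (Finset.univ.filter fun u : V => G.Reachable u v).sup f := by
  refine le_antisymm (prop_upper G f k v) (Finset.sup_le fun u hu => ?_)
  simp only [Finset.mem_filter, Finset.mem_univ, true_and] at hu
  obtain ⟨p, hp⟩ := hu.symm.exists_isPath
  exact prop_lower G f p k (hp.length_lt.le.trans hk)
end
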